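/- Let n be a positive integer and let W be a 2π-periodic weight function. Suppose D ⊂ [-π, π] is a Lebesgue measurable set such that |D| ≤ (1-η)²·2π/(2n+1) for some 0 < η < 1. Then for every nonnegative, not identically zero trigonometric polynomial p of degree at most n: ∫_{-π}^{π} p(θ)W(θ)dθ ≥ η·(essinf_{θ ∈ [-π,π]\D} W(θ))·∫_{-π}^{π} p(θ)dθ. -/

import Mathlib

open MeasureTheory Real Set

noncomputable section

/-- A trigonometric polynomial of degree at most `n`. -/
def IsTrigPoly (n : ℕ) (p : ℝ → ℝ) : Prop :=
  ∃ a b : ℕ → ℝ, ∀ θ : ℝ,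
    p θ = a 0 + ∑ k ∈ Finset.Icc 1 n, (a k * Real.cos (k * θ) + b k * Real.sin (k * θ))

/-- A `2π`-periodic weight function. -/
def IsPeriodicWeight (W : ℝ → ℝ) : Prop :=
  Measurable W ∧ (∀ θ, 0 ≤ W θ) ∧ Function.Periodic W (2 * π) ∧
  IntervalIntegrable W volume (-π) π ∧ 0 < ∫ θ in (-π)..π, W θ

theorem sum_exp_equispaced_eq_zero {N k : ℕ} (hk : 0 < k) (hkN : k < N) (θ : ℝ) :
    ∑ j ∈ Finset.range N, Complex.exp (((k * (θ + 2 * π * j / N) : ℝ) : ℂ) * Complex.I) = 0 := by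
  have hN : N ≠ 0 := by omega
  have hζ := Complex.isPrimitiveRoot_exp N hN
  set ζ := Complex.exp (2 * π * Complex.I / N) with hζdef
  have hterm : ∀ j ∈ Finset.range N,
      Complex.exp (((k * (θ + 2 * π * j / N) : ℝ) : ℂ) * Complex.I) =
        Complex.exp (k * θ * Complex.I) * (ζ ^ k) ^ j := by
    intro j _
    rw [hζdef, ← pow_mul, ← Complex.exp_nat_mul, ← Complex.exp_add]
    congr 1
    push_cast
    ring
  rw [Finset.sum_congr rfl hterm, ← Finset.mul_sum]
  have hne : ζ ^ k - 1 ≠ 0 := sub_ne_zero.mpr (hζ.pow_ne_one_of_pos_of_lt hk.ne' hkN)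
  have hgeom : (ζ ^ k - 1) * ∑ j ∈ Finset.range N, (ζ ^ k) ^ j = 0 := by
    rw [mul_geom_sum, ← pow_mul, mul_comm k, pow_mul, hζ.pow_eq_one, one_pow, sub_self]
  rw [(mul_eq_zero.mp hgeom).resolve_left hne, mul_zero]

theorem sum_cos_equispaced_eq_zero {N k : ℕ} (hk : 0 < k) (hkN : k < N) (θ : ℝ) :
    ∑ j ∈ Finset.range N, Real.cos (k * (θ + 2 * π * j / N)) = 0 := by
  simpa only [Complex.re_sum, Complex.exp_ofReal_mul_I_re, Complex.zero_re] using
    congrArg Complex.re (sum_exp_equispaced_eq_zero hk hkN θ)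

theorem sum_sin_equispaced_eq_zero {N k : ℕ} (hk : 0 < k) (hkN : k < N) (θ : ℝ) :
    ∑ j ∈ Finset.range N, Real.sin (k * (θ + 2 * π * j / N)) = 0 := by
  simpa only [Complex.im_sum, Complex.exp_ofReal_mul_I_im, Complex.zero_im] using
    congrArg Complex.im (sum_exp_equispaced_eq_zero hk hkN θ)

theorem IsTrigPoly.continuous {n : ℕ} {p : ℝ → ℝ} (hp : IsTrigPoly n p) : Continuous p := by
  obtain ⟨a, b, h⟩ := hp
  rw [funext h]
  fun_prop

theorem integral_cos_nat_mul {k : ℕ} (hk : k ≠ 0) : ∫ θ in (-π)..π, Real.cos (k * θ) = 0 := by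
  rw [intervalIntegral.integral_comp_mul_left _ (Nat.cast_ne_zero.mpr hk), integral_cos]
  simp [Real.sin_nat_mul_pi]

theorem integral_sin_nat_mul {k : ℕ} (hk : k ≠ 0) : ∫ θ in (-π)..π, Real.sin (k * θ) = 0 := by
  rw [intervalIntegral.integral_comp_mul_left _ (Nat.cast_ne_zero.mpr hk), integral_sin]
  simp

/-- The equispaced quadrature rule with `N > n` nodes is exact on trigonometric polynomials of
degree at most `n`. -/
theorem IsTrigPoly.sum_equispaced {n N : ℕ} {p : ℝ → ℝ} (hp : IsTrigPoly n p) (hN : n < N)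
    (θ : ℝ) :
    ∑ j ∈ Finset.range N, p (θ + 2 * π * j / N) = N / (2 * π) * ∫ t in (-π)..π, p t := by
  obtain ⟨a, b, h⟩ := hp
  have hint : ∫ t in (-π)..π, p t = 2 * π * a 0 := by
    simp_rw [h]
    rw [intervalIntegral.integral_add (by simp)
      (Continuous.intervalIntegrable (by fun_prop) _ _),
      intervalIntegral.integral_finsetSum
        (fun k _ => Continuous.intervalIntegrable (by fun_prop) _ _),
      Finset.sum_eq_zero, intervalIntegral.integral_const, smul_eq_mul]
    · ring
    · intro k hk
      have hk0 : k ≠ 0 := by have := Finset.mem_Icc.mp hk; omega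
      rw [intervalIntegral.integral_add (Continuous.intervalIntegrable (by fun_prop) _ _)
        (Continuous.intervalIntegrable (by fun_prop) _ _),
        intervalIntegral.integral_const_mul, intervalIntegral.integral_const_mul,
        integral_cos_nat_mul hk0, integral_sin_nat_mul hk0]
      simp
  have hsum : ∑ j ∈ Finset.range N, p (θ + 2 * π * j / N) = N * a 0 := by
    simp_rw [h]
    rw [Finset.sum_add_distrib, Finset.sum_comm, Finset.sum_eq_zero (s := Finset.Icc 1 n)]
    · simp
    · intro k hk
      have := Finset.mem_Icc.mp hk
      rw [Finset.sum_add_distrib, ← Finset.mul_sum, ← Finset.mul_sum,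
        sum_cos_equispaced_eq_zero (by omega) (by omega),
        sum_sin_equispaced_eq_zero (by omega) (by omega)]
      simp
  rw [hsum, hint]
  field_simp

theorem IsTrigPoly.le_mul_integral {n N : ℕ} {p : ℝ → ℝ} (hp : IsTrigPoly n p)
    (hp0 : ∀ θ, 0 ≤ p θ) (hN : n < N) (θ : ℝ) :
    p θ ≤ N / (2 * π) * ∫ t in (-π)..π, p t := by
  rw [← hp.sum_equispaced hN θ]
  have := Finset.single_le_sum (f := fun j : ℕ => p (θ + 2 * π * j / N)) (s := Finset.range N)
    (fun j _ => hp0 _) (Finset.mem_range.mpr (by omega : 0 < N))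
  simpa using this

theorem lower_bound_integral_against_weight (n : ℕ) (hn : 1 ≤ n)
    (W : ℝ → ℝ) (hW : IsPeriodicWeight W)
    (η : ℝ) (hη0 : 0 < η) (hη1 : η < 1)
    (D : Set ℝ) (hD : D ⊆ Icc (-π) π) (hDmeas : MeasurableSet D)
    (hDvol : (volume D).toReal ≤ (1 - η) ^ 2 * (2 * π) / (2 * n + 1))
    (p : ℝ → ℝ) (hp : IsTrigPoly n p) (hp0 : ∀ θ, 0 ≤ p θ) (hpne : p ≠ 0) :
    η * essInf W (volume.restrict (Icc (-π) π \ D)) * (∫ θ in (-π)..π, p θ) ≤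
      ∫ θ in (-π)..π, p θ * W θ := by
  obtain ⟨-, hW0, -, hWint, -⟩ := hW
  have hππ : -π ≤ π := by linarith [pi_pos]
  set I := ∫ θ in (-π)..π, p θ with hI
  set m := essInf W (volume.restrict (Icc (-π) π \ D))
  have hI0 : 0 ≤ I := intervalIntegral.integral_nonneg hππ fun θ _ => hp0 θ
  have hR0 : 0 ≤ ∫ θ in (-π)..π, p θ * W θ :=
    intervalIntegral.integral_nonneg hππ fun θ _ => mul_nonneg (hp0 θ) (hW0 θ)
  rcases lt_or_ge m 0 with hm0 | hm0
  · exact (mul_nonpos_of_nonpos_of_nonneg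
      (mul_nonpos_of_nonneg_of_nonpos hη0.le hm0.le) hI0).trans hR0
  have hpI : IntegrableOn p (Icc (-π) π) := hp.continuous.continuousOn.integrableOn_Icc
  have hpWI : IntegrableOn (fun θ => p θ * W θ) (Icc (-π) π) :=
    (intervalIntegrable_iff_integrableOn_Icc_of_le hππ).mp
      (hWint.continuousOn_mul hp.continuous.continuousOn)
  have hIset : I = ∫ θ in Icc (-π) π, p θ := by
    rw [hI, intervalIntegral.integral_of_le hππ, integral_Icc_eq_integral_Ioc]
  have hae : ∀ᵐ θ ∂volume.restrict (Icc (-π) π \ D), m ≤ W θ :=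
    ae_essInf_le (Filter.isBoundedUnder_of ⟨0, hW0⟩)
  have hDfin : volume D ≠ ⊤ := (measure_mono hD |>.trans_lt measure_Icc_lt_top).ne
  have hDint : ∫ θ in D, p θ ≤ (1 - η) * I := by
    have hbound : ∀ θ, p θ ≤ (2 * n + 1) / (2 * π) * I := fun θ => by
      simpa using hp.le_mul_integral hp0 (by omega : n < 2 * n + 1) θ
    calc ∫ θ in D, p θ ≤ ∫ _ in D, (2 * n + 1) / (2 * π) * I :=
          setIntegral_mono (hpI.mono_set hD) (integrableOn_const hDfin) hbound
      _ = (volume D).toReal * ((2 * n + 1) / (2 * π) * I) := by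
          rw [setIntegral_const, smul_eq_mul, Measure.real]
      _ ≤ (1 - η) ^ 2 * (2 * π) / (2 * n + 1) * ((2 * n + 1) / (2 * π) * I) := by
          gcongr
      _ = (1 - η) ^ 2 * I := by
          have := pi_pos
          field_simp
      _ ≤ (1 - η) * I := by
          gcongr
          nlinarith
  have hdiff : η * I ≤ ∫ θ in Icc (-π) π \ D, p θ := by
    rw [setIntegral_sdiff hDmeas hpI hD, ← hIset]
    linarith
  calc η * m * I = m * (η * I) := by ring
    _ ≤ m * ∫ θ in Icc (-π) π \ D, p θ := by gcongr
    _ = ∫ θ in Icc (-π) π \ D, m * p θ := (integral_const_mul _ _).symm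
    _ ≤ ∫ θ in Icc (-π) π \ D, p θ * W θ := by
        refine integral_mono_ae ((hpI.mono_set sdiff_subset).const_mul m)
          (hpWI.mono_set sdiff_subset) ?_
        filter_upwards [hae] with θ hθ
        rw [mul_comm]
        exact mul_le_mul_of_nonneg_left hθ (hp0 θ)
    _ ≤ ∫ θ in Icc (-π) π, p θ * W θ :=
        setIntegral_mono_set hpWI (.of_forall fun θ => mul_nonneg (hp0 θ) (hW0 θ))
          sdiff_subset.eventuallyLE
    _ = ∫ θ in (-π)..π, p θ * W θ := by
        rw [intervalIntegral.integral_of_le hππ, integral_Icc_eq_integral_Ioc]
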